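/- Proposition 2 (multi-view stability of MISL): Let m ≥ 1, c > 0, C₂ > 0, and W_v ∈ ℝ^{D_v×d} with operator norm ‖W_v‖ ≤ Ω_v for v = 1,…,m. Let z = (z^1,…,z^m) and ẑ = (ẑ^1,…,ẑ^m) be multi-view points with ẑ^v = z^v for all v ≠ k and ‖ẑ^k − z^k‖ = |τ|. Define R(z, y) = (1/m) Σ_{v=1}^m log(1 + ‖z^v − W_v y‖²/c²), and suppose x minimizes y ↦ R(z, y) + C₂‖y‖² over ℝ^d, x̂ minimizes y ↦ R(ẑ, y) + C₂‖y‖² over ℝ^d, and y ↦ R(ẑ, y) is convex on the segment joining x and x̂. With f_v(w, y) = log(1 + ‖w − W_v y‖²/c²), it holds that Σ_{v=1}^m |f_v(z^v, x) − f_v(ẑ^v, x̂)| ≤ (√2/c)|τ| + Σ_{v=1}^m (128^{1/4} Ω_v / c) √( |τ| / (m c C₂) ). -/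

import Mathlib

/-- The function `p ↦ log (1 + p ^ 2)` is `1`-Lipschitz. -/
lemma abs_log_one_add_sq_sub_le (p q : ℝ) :
    |Real.log (1 + p ^ 2) - Real.log (1 + q ^ 2)| ≤ |p - q| := by
  have hderiv : ∀ s ∈ (Set.univ : Set ℝ), HasDerivWithinAt (fun s : ℝ => Real.log (1 + s ^ 2))
      (2 * s / (1 + s ^ 2)) Set.univ s := by
    intro s _
    have hs : HasDerivAt (fun s : ℝ => 1 + s ^ 2) (2 * s) s := by
      simpa using (hasDerivAt_pow 2 s).const_add 1
    exact (hs.log (by positivity)).hasDerivWithinAt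
  have hbound : ∀ s ∈ (Set.univ : Set ℝ), ‖2 * s / (1 + s ^ 2)‖ ≤ 1 := by
    intro s _
    rw [Real.norm_eq_abs, abs_le]
    have hpos : 0 < 1 + s ^ 2 := by positivity
    constructor
    · rw [le_div_iff₀ hpos]
      nlinarith [sq_nonneg (s + 1)]
    · rw [div_le_iff₀ hpos]
      nlinarith [sq_nonneg (s - 1)]
  simpa using convex_univ.norm_image_sub_le_of_norm_hasDerivWithin_le hderiv hbound
    (Set.mem_univ q) (Set.mem_univ p)

/-- The Cauchy loss `u ↦ log (1 + ‖u‖ ^ 2 / c ^ 2)` is `1 / c`-Lipschitz. -/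
lemma abs_cauchyLoss_sub_le {E : Type*} [SeminormedAddCommGroup E] {c : ℝ} (hc : 0 < c)
    (u w : E) :
    |Real.log (1 + ‖u‖ ^ 2 / c ^ 2) - Real.log (1 + ‖w‖ ^ 2 / c ^ 2)| ≤ ‖u - w‖ / c := by
  rw [← div_pow, ← div_pow]
  refine (abs_log_one_add_sq_sub_le _ _).trans ?_
  rw [← sub_div, abs_div, abs_of_pos hc]
  gcongr
  exact abs_norm_sub_norm_le u w

/-- If `G + C * ‖·‖ ^ 2` is minimal at `b` and `G` is midpoint convex for `a` and `b`, then the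
regularized objective grows at least quadratically from `b` to `a`. -/
lemma half_mul_norm_sub_sq_le_of_isMin {E : Type*} [NormedAddCommGroup E]
    [InnerProductSpace ℝ E] {G : E → ℝ} {C : ℝ} {a b : E}
    (hmin : ∀ y, G b + C * ‖b‖ ^ 2 ≤ G y + C * ‖y‖ ^ 2)
    (hmid : G (a + (1 / 2 : ℝ) • (b - a)) ≤ (1 - 1 / 2) * G a + 1 / 2 * G b) :
    C * ‖a - b‖ ^ 2 / 2 ≤ (G a + C * ‖a‖ ^ 2) - (G b + C * ‖b‖ ^ 2) := by
  have h := hmin (a + (1 / 2 : ℝ) • (b - a))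
  have hnorm : ‖a + (1 / 2 : ℝ) • (b - a)‖ ^ 2
      = ‖a‖ ^ 2 / 2 + ‖b‖ ^ 2 / 2 - ‖a - b‖ ^ 2 / 4 := by
    have hrw : a + (1 / 2 : ℝ) • (b - a) = (1 / 2 : ℝ) • (a + b) := by module
    have hpar := parallelogram_law_with_norm ℝ a b
    rw [hrw, norm_smul, mul_pow]
    norm_num
    linarith
  rw [hnorm] at h
  linarith

lemma four_le_rpow_quarter_sq : (4 : ℝ) ≤ ((128 : ℝ) ^ ((1 : ℝ) / 4)) ^ 2 := by
  rw [← Real.rpow_natCast, ← Real.rpow_mul (by norm_num)]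
  norm_num
  rw [← Real.sqrt_eq_rpow]
  exact Real.le_sqrt_of_sq_le (by norm_num)

/-- Proposition 2 (multi-view stability of MISL): with `f_v(w, y) =
log(1 + ‖w − W_v y‖²/c²)` and `‖W_v‖ ≤ Ω_v` (operator norm), if `x` and `x'`
are the regularized Cauchy-loss minimizers for two multi-view points `z` and
`z'` differing only in the `k`-th view by `‖z' k − z k‖ = |τ|`, and `R(z', ·)`
is convex on the segment joining `x` and `x'`, then
`Σ_v |f_v(z^v, x) − f_v(z'^v, x')| ≤ (√2/c)|τ| + Σ_v (128^{1/4} Ω_v / c) √(|τ|/(m c C₂))`. -/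
theorem misl_multiview_stability
    {d m : ℕ} (hm : 1 ≤ m) {D : Fin m → ℕ}
    (c C₂ τ : ℝ) (hc : 0 < c) (hC₂ : 0 < C₂)
    (W : ∀ v : Fin m, Matrix (Fin (D v)) (Fin d) ℝ)
    (Ω : Fin m → ℝ) (hΩ : ∀ v, 0 ≤ Ω v)
    (hWop : ∀ (v : Fin m) (y : EuclideanSpace ℝ (Fin d)),
      ‖Matrix.toEuclideanLin (W v) y‖ ≤ Ω v * ‖y‖)
    (z z' : ∀ v : Fin m, EuclideanSpace ℝ (Fin (D v)))
    (k : Fin m) (hzz' : ∀ v, v ≠ k → z' v = z v) (hτ : ‖z' k - z k‖ = |τ|)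
    (R : (∀ v : Fin m, EuclideanSpace ℝ (Fin (D v))) → EuclideanSpace ℝ (Fin d) → ℝ)
    (hR : ∀ w y, R w y = (1 / (m : ℝ)) * ∑ v : Fin m,
      Real.log (1 + ‖w v - Matrix.toEuclideanLin (W v) y‖ ^ 2 / c ^ 2))
    (x x' : EuclideanSpace ℝ (Fin d))
    (hxmin : ∀ y, R z x + C₂ * ‖x‖ ^ 2 ≤ R z y + C₂ * ‖y‖ ^ 2)
    (hx'min : ∀ y, R z' x' + C₂ * ‖x'‖ ^ 2 ≤ R z' y + C₂ * ‖y‖ ^ 2)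
    (hconv : ∀ t ∈ Set.Icc (0 : ℝ) 1,
      R z' (x + t • (x' - x)) ≤ (1 - t) * R z' x + t * R z' x' ∧
      R z' (x' + t • (x - x')) ≤ (1 - t) * R z' x' + t * R z' x) :
    ∑ v : Fin m,
        |Real.log (1 + ‖z v - Matrix.toEuclideanLin (W v) x‖ ^ 2 / c ^ 2)
          - Real.log (1 + ‖z' v - Matrix.toEuclideanLin (W v) x'‖ ^ 2 / c ^ 2)|
      ≤ (Real.sqrt 2 / c) * |τ|
        + ∑ v : Fin m, ((128 : ℝ) ^ ((1 : ℝ) / 4) * Ω v / c)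
            * Real.sqrt (|τ| / (m * c * C₂)) := by
  have hmpos : (0 : ℝ) < m := by exact_mod_cast hm
  have hcont : ∀ y, |R z' y - R z y| ≤ |τ| / (m * c) := by
    intro y
    rw [hR, hR, ← mul_sub, ← Finset.sum_sub_distrib,
      Finset.sum_eq_single k (fun v _ hv => by rw [hzz' v hv, sub_self]) (by simp),
      abs_mul, abs_of_pos (by positivity : (0 : ℝ) < 1 / m)]
    calc _ ≤ 1 / (m : ℝ) * (‖(z' k - Matrix.toEuclideanLin (W k) y)
              - (z k - Matrix.toEuclideanLin (W k) y)‖ / c) := by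
            gcongr
            exact abs_cauchyLoss_sub_le hc _ _
      _ = |τ| / (m * c) := by
            rw [sub_sub_sub_cancel_right, hτ]
            field_simp
  have hgrowth := half_mul_norm_sub_sq_le_of_isMin hx'min
    (hconv (1 / 2) ⟨by norm_num, by norm_num⟩).1
  have hsq : ‖x - x'‖ ^ 2 ≤ 4 * (|τ| / (m * c * C₂)) := by
    have h1 := (abs_le.1 (hcont x)).2
    have h2 := (abs_le.1 (hcont x')).1
    have h3 := hxmin x'
    have h4 : ‖x - x'‖ ^ 2 * C₂ ≤ 4 * (|τ| / (m * c)) := by linarith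
    rw [← div_div, ← mul_div_assoc, le_div_iff₀ hC₂]
    exact h4
  have hdist : ‖x - x'‖ ≤ (128 : ℝ) ^ ((1 : ℝ) / 4) * Real.sqrt (|τ| / (m * c * C₂)) := by
    refine le_of_sq_le_sq ?_ (by positivity)
    rw [mul_pow, Real.sq_sqrt (by positivity)]
    exact hsq.trans (mul_le_mul_of_nonneg_right four_le_rpow_quarter_sq (by positivity))
  have hview : ∀ v, |Real.log (1 + ‖z v - Matrix.toEuclideanLin (W v) x‖ ^ 2 / c ^ 2)
        - Real.log (1 + ‖z' v - Matrix.toEuclideanLin (W v) x'‖ ^ 2 / c ^ 2)|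
      ≤ ‖z' v - z v‖ / c + ((128 : ℝ) ^ ((1 : ℝ) / 4) * Ω v / c)
            * Real.sqrt (|τ| / (m * c * C₂)) := by
    intro v
    have hsplit : (z v - Matrix.toEuclideanLin (W v) x) - (z' v - Matrix.toEuclideanLin (W v) x')
        = (z v - z' v) - Matrix.toEuclideanLin (W v) (x - x') := by
      rw [map_sub]
      abel
    calc _ ≤ ‖(z v - z' v) - Matrix.toEuclideanLin (W v) (x - x')‖ / c := by
            rw [← hsplit]
            exact abs_cauchyLoss_sub_le hc _ _
      _ ≤ (‖z' v - z v‖ + Ω v *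
            ((128 : ℝ) ^ ((1 : ℝ) / 4) * Real.sqrt (|τ| / (m * c * C₂)))) / c := by
            gcongr
            refine (norm_sub_le _ _).trans (add_le_add (norm_sub_rev _ _).le ?_)
            exact (hWop v _).trans (mul_le_mul_of_nonneg_left hdist (hΩ v))
      _ = _ := by ring
  have hsum : ∑ v, ‖z' v - z v‖ / c = |τ| / c := by
    rw [Finset.sum_eq_single k (fun v _ hv => by simp [hzz' v hv]) (by simp), hτ]
  have hsqrt : |τ| / c ≤ Real.sqrt 2 / c * |τ| := by
    rw [div_mul_eq_mul_div]
    gcongr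
    exact le_mul_of_one_le_left (abs_nonneg τ) (Real.one_le_sqrt.2 one_le_two)
  refine (Finset.sum_le_sum fun v _ => hview v).trans ?_
  rw [Finset.sum_add_distrib, hsum]
  gcongr
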